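/- arXiv:1611.07891 — 2 statements merged into one kernel-verified Lean document; each statement's English description precedes it below -/
import Mathlib

section
/- Let P: ℝ^d → ℝ^s be continuously differentiable, D ⊂ ℝ^s closed and convex, z̄ ∈ Ω := {z | P(z) ∈ D}, and assume the metric subregularity constraint qualification holds at z̄ for the system P(z) ∈ D. Then N̂_Ω(z̄) = N_Ω(z̄) = ∇P(z̄)^T N_D(P(z̄)), where N_D(P(z̄)) is the convex-analysis normal cone to D at P(z̄). -/
open Filter Topology Set
open scoped RealInnerProductSpace

noncomputable section

/-- `ℝ^d` as a Euclidean space. -/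
abbrev Eu (d : ℕ) := EuclideanSpace ℝ (Fin d)

/-- The (Fréchet) regular normal cone to `Ω` at `zb`. -/
def rnc {E : Type*} [NormedAddCommGroup E] [InnerProductSpace ℝ E]
    (Ω : Set E) (zb : E) : Set E :=
  {v | ∀ ε > (0 : ℝ), ∃ δ > (0 : ℝ), ∀ z ∈ Ω, ‖z - zb‖ < δ →
    ⟪v, z - zb⟫ ≤ ε * ‖z - zb‖}

/-- The (Mordukhovich) limiting normal cone to `Ω` at `zb`. -/
def lnc {E : Type*} [NormedAddCommGroup E] [InnerProductSpace ℝ E]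
    (Ω : Set E) (zb : E) : Set E :=
  {v | ∃ z : ℕ → E, ∃ w : ℕ → E, (∀ k, z k ∈ Ω) ∧ Tendsto z atTop (𝓝 zb) ∧
    Tendsto w atTop (𝓝 v) ∧ ∀ k, w k ∈ rnc Ω (z k)}

/-- Metric subregularity of a set-valued map at a point of its graph. -/
def msr {E F : Type*} [NormedAddCommGroup E] [NormedAddCommGroup F]
    (M : E → Set F) (zb : E) (wb : F) : Prop :=
  ∃ κ : ℝ, 0 < κ ∧ ∃ W ∈ 𝓝 zb, ∀ z ∈ W,
    EMetric.infEdist z {z' | wb ∈ M z'} ≤ ENNReal.ofReal κ * EMetric.infEdist wb (M z)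

/-- If `w` is bounded by `K` times the distance of `A h` to the tangent cone of `D` at `y` in every
direction `h`, then `w` is the image under `A†` of a normal to `D` at `y` of norm at most `K`. -/
lemma exists_normal_eq_adjoint_of_inner_le {E F : Type*}
    [NormedAddCommGroup E] [InnerProductSpace ℝ E] [FiniteDimensional ℝ E]
    [NormedAddCommGroup F] [InnerProductSpace ℝ F] [FiniteDimensional ℝ F]
    {D : Set F} (hconv : Convex ℝ D) {y : F} (hy : y ∈ D) (A : E →L[ℝ] F) (w : E)
    {K : ℝ} (hK : 0 ≤ K)
    (hw : ∀ h : E, ∀ e ∈ D, ∀ c : ℝ, 0 < c → ⟪w, h⟫ ≤ K * ‖A h - c • (e - y)‖) :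
    ∃ l : F, ‖l‖ ≤ K ∧ (∀ e ∈ D, ⟪l, e - y⟫ ≤ 0) ∧ w = ContinuousLinearMap.adjoint A l := by
  set N : Set F := {l | ∀ e ∈ D, ⟪l, e - y⟫ ≤ 0} with hN
  have hNclosed : IsClosed N := by
    simp only [hN, ofPred_forall]
    exact isClosed_iInter fun e => isClosed_iInter fun _ =>
      isClosed_le (by fun_prop) continuous_const
  have hNconv : Convex ℝ N := by
    intro l hl m hm a b ha hb _ e he
    rw [inner_add_left, real_inner_smul_left, real_inner_smul_left]
    have := mul_nonpos_of_nonneg_of_nonpos ha (hl e he)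
    have := mul_nonpos_of_nonneg_of_nonpos hb (hm e he)
    linarith
  set B : Set F := Metric.closedBall 0 K ∩ N
  have hBcompact : IsCompact B := (isCompact_closedBall 0 K).inter_right hNclosed
  have hBconv : Convex ℝ B := (convex_closedBall 0 K).inter hNconv
  suffices hmem : w ∈ ContinuousLinearMap.adjoint A '' B by
    obtain ⟨l, ⟨hl, hlN⟩, rfl⟩ := hmem
    exact ⟨l, by simpa using hl, hlN, rfl⟩
  by_contra hnot
  have hCconv : Convex ℝ (ContinuousLinearMap.adjoint A '' B) :=
    hBconv.linear_image (ContinuousLinearMap.adjoint A).toLinearMap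
  obtain ⟨f, u, hf, hu⟩ := geometric_hahn_banach_closed_point hCconv
    (hBcompact.image (ContinuousLinearMap.adjoint A).continuous).isClosed hnot
  obtain ⟨h, rfl⟩ := (InnerProductSpace.toDual ℝ E).surjective f
  simp only [InnerProductSpace.toDual_apply_apply] at hf hu
  have hconv' : Convex ℝ ((fun e => e - y) '' D) := by
    simpa [sub_eq_add_neg, add_comm] using hconv.translate (-y)
  set T : ConvexCone ℝ F := (ConvexCone.hull ℝ ((fun e => e - y) '' D)).closure
  have hsub : ∀ e ∈ D, e - y ∈ T := fun e he =>
    subset_closure (ConvexCone.subset_hull (mem_image_of_mem _ he))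
  have h0 : (0 : F) ∈ T := by simpa using hsub y hy
  have hwT : ∀ q ∈ T, ⟪w, h⟫ ≤ K * ‖A h - q‖ := by
    intro q hq
    have hcl : IsClosed {q : F | ⟪w, h⟫ ≤ K * ‖A h - q‖} :=
      isClosed_le continuous_const (by fun_prop)
    refine closure_minimal ?_ hcl hq
    rintro q hq
    obtain ⟨c, hc, _, ⟨e, he, rfl⟩, rfl⟩ := (ConvexCone.mem_hull_of_convex hconv').1 hq
    exact hw h e he c hc
  obtain ⟨p, hp, hpmin⟩ := exists_norm_eq_iInf_of_complete_convex (K := (T : Set F)) ⟨0, h0⟩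
    (isClosed_closure.isComplete) T.convex (A h)
  rw [norm_eq_iInf_iff_real_inner_le_zero T.convex hp] at hpmin
  set m := A h - p with hm
  have hmp : ⟪m, p⟫ = 0 := by
    have h1 := hpmin 0 h0
    have h2 := hpmin ((2 : ℝ) • p) (T.smul_mem two_pos hp)
    simp only [inner_sub_right, inner_zero_right, real_inner_smul_right] at h1 h2
    linarith
  have hmD : ∀ e ∈ D, ⟪m, e - y⟫ ≤ 0 := by
    intro e he
    have := hpmin _ (hsub e he)
    rw [inner_sub_right, hmp] at this
    linarith
  have hl : (K / ‖m‖) • m ∈ B := by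
    refine ⟨?_, fun e he => ?_⟩
    · rw [mem_closedBall_zero_iff, norm_smul, Real.norm_of_nonneg (by positivity)]
      rw [div_mul_eq_mul_div, mul_div_assoc]
      exact mul_le_of_le_one_right hK (div_self_le_one _)
    · rw [real_inner_smul_left]
      exact mul_nonpos_of_nonneg_of_nonpos (by positivity) (hmD e he)
  have h1 := hf _ (mem_image_of_mem _ hl)
  have hAm : ⟪m, A h⟫ = ‖m‖ * ‖m‖ := by
    rw [← real_inner_self_eq_norm_mul_norm]
    conv_rhs => rw [hm, inner_sub_right, ← hm, hmp, sub_zero]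
  rw [real_inner_comm, ContinuousLinearMap.adjoint_inner_left, real_inner_smul_left, hAm,
    div_mul_eq_mul_div, mul_div_assoc, mul_self_div_self] at h1
  rw [real_inner_comm] at hu
  linarith [hwT p hp]

/-- Under a metric subregularity estimate near `z`, a regular normal to the feasible set is bounded
by a multiple of the distance to the linearized tangent cone. -/
lemma inner_le_of_mem_rnc {E F : Type*}
    [NormedAddCommGroup E] [InnerProductSpace ℝ E]
    [NormedAddCommGroup F] [InnerProductSpace ℝ F]
    {P : E → F} {D : Set F} (hconv : Convex ℝ D) {z : E} (hz : P z ∈ D)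
    {A : E →L[ℝ] F} (hA : HasFDerivAt P A z) {κ : ℝ} (hκ : 0 < κ)
    (hreg : ∀ᶠ x in 𝓝 z, Metric.infEDist x {z' | P z' ∈ D} ≤
      ENNReal.ofReal κ * Metric.infEDist 0 {v | P x - v ∈ D})
    {w : E} (hw : w ∈ rnc {z' | P z' ∈ D} z) (h : E) {e : F} (he : e ∈ D) {c : ℝ} (hc : 0 < c) :
    ⟪w, h⟫ ≤ κ * ‖w‖ * ‖A h - c • (e - P z)‖ := by
  set ρ := ‖A h - c • (e - P z)‖ with hρ
  have hρ0 : 0 ≤ ρ := norm_nonneg _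
  have key : ∀ η : ℝ, 0 < η →
      ⟪w, h⟫ ≤ η * (‖h‖ + (κ * (ρ + η) + η)) + ‖w‖ * (κ * (ρ + η) + η) := by
    intro η hη
    set β := κ * (ρ + η) + η with hβ
    have hβ0 : 0 < β := by positivity
    obtain ⟨δ, hδ, hwδ⟩ := hw η hη
    have hline : Tendsto (fun t : ℝ => z + t • h) (𝓝[>] 0) (𝓝 z) := by
      have : Continuous fun t : ℝ => z + t • h := by fun_prop
      simpa using (this.tendsto 0).mono_left nhdsWithin_le_nhds
    have hder : ∀ᶠ t : ℝ in 𝓝[>] 0, ‖P (z + t • h) - P z - t • A h‖ ≤ η * ‖t‖ := by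
      have := (hA.hasLineDerivAt h)
      rw [HasLineDerivAt, hasDerivAt_iff_isLittleO_nhds_zero] at this
      simpa using (this.bound hη).filter_mono nhdsWithin_le_nhds
    have hsmall : ∀ r : ℝ, 0 < r → ∀ᶠ t : ℝ in 𝓝[>] 0, t < r := fun r hr =>
      (eventually_lt_nhds hr).filter_mono nhdsWithin_le_nhds
    obtain ⟨t, ht, hreg, hder, htc, htδ⟩ := ((eventually_mem_nhdsWithin).and
      ((hline.eventually hreg).and (hder.and ((hsmall c⁻¹ (by positivity)).and
      (hsmall (δ / (‖h‖ + β)) (by positivity)))))).exists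
    have ht0 : 0 < t := ht
    rw [Real.norm_of_nonneg ht0.le] at hder
    have hmem : P z + t • c • (e - P z) ∈ D := by
      rw [smul_smul]
      refine hconv.add_smul_sub_mem hz he ⟨by positivity, ?_⟩
      rw [← inv_mul_cancel₀ hc.ne']
      gcongr
    have hdist : Metric.infEDist 0 {v | P (z + t • h) - v ∈ D} ≤ ENNReal.ofReal (t * (ρ + η)) := by
      refine (Metric.infEDist_le_edist_of_mem
        (y := P (z + t • h) - (P z + t • c • (e - P z))) (by simpa using hmem)).trans ?_
      rw [edist_dist, dist_zero_left]
      apply ENNReal.ofReal_le_ofReal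
      have hsplit : P (z + t • h) - (P z + t • c • (e - P z)) =
          (P (z + t • h) - P z - t • A h) + t • (A h - c • (e - P z)) := by
        rw [smul_sub t (A h)]; abel
      rw [hsplit]
      refine (norm_add_le _ _).trans ?_
      rw [norm_smul, Real.norm_of_nonneg ht0.le, ← hρ]
      linarith
    have hlt : Metric.infEDist (z + t • h) {z' | P z' ∈ D} < ENNReal.ofReal (t * β) := by
      refine (hreg.trans (mul_le_mul_right hdist _)).trans_lt ?_
      rw [← ENNReal.ofReal_mul hκ.le, ENNReal.ofReal_lt_ofReal_iff (by positivity)]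
      have : 0 < t * η := by positivity
      rw [hβ]
      linarith
    obtain ⟨u, hu, hut⟩ := Metric.infEDist_lt_iff.1 hlt
    rw [edist_dist, ENNReal.ofReal_lt_ofReal_iff (by positivity), dist_comm, dist_eq_norm] at hut
    have huz : ‖u - z‖ ≤ t * (‖h‖ + β) := by
      have : u - z = (u - (z + t • h)) + t • h := by abel
      rw [this]
      refine (norm_add_le _ _).trans ?_
      rw [norm_smul, Real.norm_of_nonneg ht0.le]
      linarith
    have h1 := hwδ u hu (huz.trans_lt ((lt_div_iff₀ (by positivity)).1 htδ))
    have h2 : -⟪w, u - (z + t • h)⟫ ≤ ‖w‖ * (t * β) :=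
      (neg_le_abs _).trans ((abs_real_inner_le_norm _ _).trans (by gcongr))
    have h3 : t * ⟪w, h⟫ = ⟪w, u - z⟫ - ⟪w, u - (z + t • h)⟫ := by
      rw [← inner_sub_right, ← real_inner_smul_right]
      congr 1
      abel
    have h4 : η * ‖u - z‖ ≤ η * (t * (‖h‖ + β)) := by gcongr
    refine le_of_mul_le_mul_left ?_ ht0
    linarith
  have hlim : Tendsto (fun η : ℝ => η * (‖h‖ + (κ * (ρ + η) + η)) + ‖w‖ * (κ * (ρ + η) + η))
      (𝓝[>] 0) (𝓝 (κ * ‖w‖ * ρ)) := by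
    have hcont : Continuous fun η : ℝ =>
        η * (‖h‖ + (κ * (ρ + η) + η)) + ‖w‖ * (κ * (ρ + η) + η) := by fun_prop
    convert (hcont.tendsto 0).mono_left nhdsWithin_le_nhds using 2
    ring
  exact ge_of_tendsto hlim (eventually_mem_nhdsWithin.mono key)

/-- Regular normals are limiting normals. -/
lemma rnc_subset_lnc {E : Type*} [NormedAddCommGroup E] [InnerProductSpace ℝ E]
    {Ω : Set E} {z : E} (hz : z ∈ Ω) : rnc Ω z ⊆ lnc Ω z := fun v hv =>
  ⟨fun _ => z, fun _ => v, fun _ => hz, tendsto_const_nhds, tendsto_const_nhds, fun _ => hv⟩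

/-- The adjoint derivative maps normals to `D` to regular normals to the preimage of `D`. -/
lemma adjoint_mem_rnc {E F : Type*}
    [NormedAddCommGroup E] [InnerProductSpace ℝ E] [CompleteSpace E]
    [NormedAddCommGroup F] [InnerProductSpace ℝ F] [CompleteSpace F]
    {P : E → F} {D : Set F} {z : E} {A : E →L[ℝ] F} (hA : HasFDerivAt P A z)
    {l : F} (hl : ∀ e ∈ D, ⟪l, e - P z⟫ ≤ 0) :
    ContinuousLinearMap.adjoint A l ∈ rnc {x | P x ∈ D} z := by
  intro ε hε
  have hη : 0 < ε / (‖l‖ + 1) := by positivity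
  obtain ⟨δ, hδ, hb⟩ := Metric.eventually_nhds_iff.1 (hA.isLittleO.bound hη)
  refine ⟨δ, hδ, fun x hx hxz => ?_⟩
  have h1 := hb (by rwa [dist_eq_norm])
  have h2 : -⟪l, P x - P z - A (x - z)⟫ ≤ ‖l‖ * (ε / (‖l‖ + 1) * ‖x - z‖) :=
    (neg_le_abs _).trans ((abs_real_inner_le_norm _ _).trans (by gcongr))
  have h3 : ‖l‖ * (ε / (‖l‖ + 1) * ‖x - z‖) ≤ ε * ‖x - z‖ := by
    rw [← mul_assoc]
    gcongr
    rw [mul_div_assoc', div_le_iff₀ (by positivity)]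
    linarith
  rw [ContinuousLinearMap.adjoint_inner_left]
  rw [inner_sub_right] at h2
  linarith [hl _ hx]

/-- under MSCQ at `zb` for `P(z) ∈ D` with `D` closed and convex, one has
`N̂_Ω(zb) = N_Ω(zb) = ∇P(zb)ᵀ N_D(P(zb))`, where `N_D` is the convex-analysis
normal cone. -/
theorem stmt_9 {d s : ℕ} (P : Eu d → Eu s) (D : Set (Eu s)) (zb : Eu d)
    (hP : ContDiff ℝ 1 P) (hD : IsClosed D) (hconv : Convex ℝ D) (hz : P zb ∈ D)
    (hMSCQ : msr (fun z => {w | P z - w ∈ D}) zb 0) :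
    rnc {z | P z ∈ D} zb = lnc {z | P z ∈ D} zb ∧
    lnc {z | P z ∈ D} zb =
      {zs | ∃ l : Eu s, (∀ e ∈ D, ⟪l, e - P zb⟫ ≤ 0) ∧
        zs = ContinuousLinearMap.adjoint (fderiv ℝ P zb) l} := by
  have hA : ∀ z, HasFDerivAt P (fderiv ℝ P z) z := fun z =>
    (hP.differentiable one_ne_zero z).hasFDerivAt
  have hTR : {zs | ∃ l : Eu s, (∀ e ∈ D, ⟪l, e - P zb⟫ ≤ 0) ∧
      zs = ContinuousLinearMap.adjoint (fderiv ℝ P zb) l} ⊆ rnc {z | P z ∈ D} zb := by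
    rintro _ ⟨l, hl, rfl⟩
    exact adjoint_mem_rnc (hA zb) hl
  have hRL : rnc {z | P z ∈ D} zb ⊆ lnc {z | P z ∈ D} zb := rnc_subset_lnc hz
  have hLT : lnc {z | P z ∈ D} zb ⊆ {zs | ∃ l : Eu s, (∀ e ∈ D, ⟪l, e - P zb⟫ ≤ 0) ∧
      zs = ContinuousLinearMap.adjoint (fderiv ℝ P zb) l} := by
    rintro v ⟨z, w, hzΩ, hzlim, hwlim, hw⟩
    obtain ⟨κ, hκ, W, hW, hreg⟩ := hMSCQ
    simp only [mem_ofPred_eq, sub_zero] at hreg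
    have hregk : ∀ᶠ k in atTop, ∀ᶠ x in 𝓝 (z k), Metric.infEDist x {z' | P z' ∈ D} ≤
        ENNReal.ofReal κ * Metric.infEDist 0 {v | P x - v ∈ D} :=
      hzlim.eventually (eventually_eventually_nhds.2 (eventually_of_mem hW hreg))
    have hwbd : ∀ᶠ k in atTop, ‖w k‖ < ‖v‖ + 1 :=
      hwlim.norm.eventually_lt_const (lt_add_one _)
    have hmult : ∀ᶠ k in atTop, ∃ l : Eu s, ‖l‖ ≤ κ * (‖v‖ + 1) ∧
        (∀ e ∈ D, ⟪l, e - P (z k)⟫ ≤ 0) ∧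
        w k = ContinuousLinearMap.adjoint (fderiv ℝ P (z k)) l := by
      filter_upwards [hregk, hwbd] with k hk hwk
      obtain ⟨l, hl, hlN, hlw⟩ := exists_normal_eq_adjoint_of_inner_le hconv (hzΩ k)
        (fderiv ℝ P (z k)) (w k) (by positivity) fun h e he c hc =>
          inner_le_of_mem_rnc hconv (hzΩ k) (hA _) hκ hk (hw k) h he hc
      exact ⟨l, hl.trans (by gcongr), hlN, hlw⟩
    obtain ⟨n, hn⟩ := eventually_atTop.1 hmult
    choose l hlbd hlN hlw using fun k => hn (k + n) (Nat.le_add_left n k)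
    obtain ⟨a, -, φ, hφ, hla⟩ := tendsto_subseq_of_bounded
      (Metric.isBounded_closedBall (x := (0 : Eu s)) (r := κ * (‖v‖ + 1)))
      (fun k => mem_closedBall_zero_iff.2 (hlbd k))
    have hidx : Tendsto (fun k => φ k + n) atTop atTop :=
      (tendsto_add_atTop_nat n).comp hφ.tendsto_atTop
    have hzφ := hzlim.comp hidx
    refine ⟨a, fun e he => ?_, ?_⟩
    · have hlim : Tendsto (fun k => ⟪l (φ k), e - P (z (φ k + n))⟫) atTop
          (𝓝 ⟪a, e - P zb⟫) :=
        hla.inner (tendsto_const_nhds.sub ((hP.continuous.tendsto zb).comp hzφ))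
      exact le_of_tendsto' hlim fun k => hlN (φ k) e he
    · have hadj : Tendsto (fun k => ContinuousLinearMap.adjoint (fderiv ℝ P (z (φ k + n)))) atTop
          (𝓝 (ContinuousLinearMap.adjoint (fderiv ℝ P zb))) :=
        ((ContinuousLinearMap.adjoint (𝕜 := ℝ) (E := Eu d) (F := Eu s)).continuous.tendsto _).comp
          (((hP.continuous_fderiv one_ne_zero).tendsto zb).comp hzφ)
      refine tendsto_nhds_unique (hwlim.comp hidx) ?_
      exact ((isBoundedBilinearMap_apply.continuous.tendsto (_, a)).comp (hadj.prodMk_nhds hla)).congr fun k => (hlw (φ k)).symm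
  exact ⟨hRL.antisymm (hLT.trans hTR), hLT.antisymm (hTR.trans hRL)⟩
end
end

section
/- (Bounded multiplier property under MSCQ) Let P: ℝ^d → ℝ^s be continuously differentiable, D ⊂ ℝ^s closed, and z̄ ∈ Ω := {z | P(z) ∈ D}. Suppose there are an open neighborhood W of z̄ and κ ≥ 0 such that dist(z, Ω) ≤ κ · dist(P(z), D) for all z ∈ W. Then for every z ∈ Ω ∩ W, N_Ω(z) ⊆ {z* ∈ ℝ^d | ∃ λ ∈ N_D(P(z)) with ‖λ‖ ≤ κ‖z*‖ and z* = ∇P(z)^T λ}. -/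
open Filter Topology Set
open scoped RealInnerProductSpace

noncomputable section

/-- Up to first order, a regular normal `w` to `Ω` at `z` is controlled by the distance to `Ω`. -/
theorem inner_le_infDist_of_mem_rnc {E : Type*} [NormedAddCommGroup E] [InnerProductSpace ℝ E]
    [ProperSpace E] {Ω : Set E} (hΩ : IsClosed Ω) {z w : E} (hz : z ∈ Ω) (hw : w ∈ rnc Ω z)
    {e : ℝ} (he : 0 < e) :
    ∃ r > (0 : ℝ), ∀ x, ‖x - z‖ < r →
      ⟪w, x - z⟫ ≤ ‖w‖ * Metric.infDist x Ω + 2 * e * ‖x - z‖ := by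
  obtain ⟨δ, hδ, h⟩ := hw e he
  refine ⟨δ / 2, by positivity, fun x hx => ?_⟩
  obtain ⟨p, hpΩ, hp⟩ := hΩ.exists_infDist_eq_dist ⟨z, hz⟩ x
  have hpx : ‖x - p‖ ≤ ‖x - z‖ := by
    rw [← dist_eq_norm, ← dist_eq_norm, ← hp]
    exact Metric.infDist_le_dist_of_mem hz
  have hpz : ‖p - z‖ ≤ 2 * ‖x - z‖ := by
    have := norm_sub_le (x - z) (x - p)
    rw [sub_sub_sub_cancel_left] at this
    linarith
  have h₁ := h p hpΩ (by linarith)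
  have h₂ := real_inner_le_norm w (x - p)
  have h₃ : ⟪w, x - z⟫ = ⟪w, x - p⟫ + ⟪w, p - z⟫ := by
    rw [← inner_add_right, sub_add_sub_cancel]
  rw [hp, dist_eq_norm]
  nlinarith

/-- First-order necessary condition for a minimizer, relative to `S`, of a differentiable function
perturbed by a `c`-Lipschitz term. -/
theorem inner_neg_gradient_le {E : Type*} [NormedAddCommGroup E] [InnerProductSpace ℝ E]
    {S : Set E} {h : E → ℝ} {g x : E} {c : ℝ} (hg : HasFDerivAt h (innerSL ℝ g) x)
    (hmin : ∀ᶠ x' in 𝓝 x, x' ∈ S → h x - c * ‖x' - x‖ ≤ h x') {e : ℝ} (he : 0 < e) :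
    ∃ δ > (0 : ℝ), ∀ x' ∈ S, ‖x' - x‖ < δ → ⟪-g, x' - x⟫ ≤ (c + e) * ‖x' - x‖ := by
  obtain ⟨δ, hδ, H⟩ := Metric.eventually_nhds_iff.1
    (hmin.and (hg.isLittleO.def he))
  refine ⟨δ, hδ, fun x' hx' hd => ?_⟩
  obtain ⟨h₁, h₂⟩ := H (by rwa [dist_eq_norm])
  have h₃ := h₁ hx'
  rw [Real.norm_eq_abs, innerSL_apply_apply] at h₂
  have h₄ := le_of_abs_le h₂
  rw [inner_neg_left]
  linarith

theorem norm_gradient_le {E : Type*} [NormedAddCommGroup E] [InnerProductSpace ℝ E]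
    {h : E → ℝ} {g x : E} {c : ℝ} (hg : HasFDerivAt h (innerSL ℝ g) x)
    (hmin : ∀ᶠ x' in 𝓝 x, h x - c * ‖x' - x‖ ≤ h x') {e : ℝ} (hc : 0 ≤ c) (he : 0 < e) :
    ‖g‖ ≤ c + e := by
  obtain ⟨δ, hδ, H⟩ := inner_neg_gradient_le (S := univ) hg (hmin.mono fun _ h _ => h) he
  rcases eq_or_ne g 0 with rfl | hg0
  · rw [norm_zero]; linarith
  have hgpos : 0 < ‖g‖ := norm_pos_iff.2 hg0
  set t : ℝ := δ / (2 * ‖g‖) with ht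
  have htpos : 0 < t := by positivity
  have htg : t * ‖g‖ = δ / 2 := by rw [ht]; field_simp
  have h₁ : ‖t • g‖ = t * ‖g‖ := by rw [norm_smul, Real.norm_of_nonneg htpos.le]
  have h₂ := H (x - t • g) (mem_univ _) (by
    rw [sub_sub_cancel_left, norm_neg, h₁, htg]; linarith)
  rw [sub_sub_cancel_left, norm_neg, inner_neg_neg, real_inner_smul_right,
    real_inner_self_eq_norm_sq, h₁] at h₂
  have h₃ : (t * ‖g‖) * ‖g‖ ≤ (t * ‖g‖) * (c + e) := by nlinarith
  exact le_of_mul_le_mul_left h₃ (by positivity)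

theorem hasFDerivAt_sqrt_norm_sq_add {E F : Type*} [NormedAddCommGroup E] [InnerProductSpace ℝ E]
    [NormedAddCommGroup F] [InnerProductSpace ℝ F] [CompleteSpace E] [CompleteSpace F]
    {f : E → F} {f' : E →L[ℝ] F} {x : E} (hf : HasFDerivAt f f' x) {η : ℝ} (hη : 0 < η) :
    HasFDerivAt (fun x => √(‖f x‖ ^ 2 + η ^ 2))
      (innerSL ℝ (ContinuousLinearMap.adjoint f' ((√(‖f x‖ ^ 2 + η ^ 2))⁻¹ • f x))) x := by
  have hpos : ‖f x‖ ^ 2 + η ^ 2 ≠ 0 := by positivity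
  refine ((hf.norm_sq.add_const (η ^ 2)).sqrt hpos).congr_fderiv ?_
  ext v
  simp [ContinuousLinearMap.adjoint_inner_left]
  field_simp

theorem norm_inv_sqrt_smul_le {F : Type*} [NormedAddCommGroup F] [NormedSpace ℝ F]
    (q : F) (η : ℝ) : ‖(√(‖q‖ ^ 2 + η ^ 2))⁻¹ • q‖ ≤ 1 := by
  have h : ‖q‖ ≤ √(‖q‖ ^ 2 + η ^ 2) := Real.le_sqrt_of_sq_le (by nlinarith [sq_nonneg η])
  rw [norm_smul, norm_inv, Real.norm_of_nonneg (Real.sqrt_nonneg _), inv_mul_eq_div]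
  exact div_le_one_of_le₀ h (Real.sqrt_nonneg _)

set_option maxHeartbeats 1000000 in
/-- Fuzzy multiplier rule: a regular normal `w` to the preimage of `D` under `P` at `z` is approximated by
`∇P(x)ᵀ l` with `l` a regular normal to `D` at a point near `P z`. -/
theorem exists_approx_multiplier {d s : ℕ} {P : Eu d → Eu s} {D : Set (Eu s)}
    (hP : ContDiff ℝ 1 P) (hD : IsClosed D) {W : Set (Eu d)} (hW : IsOpen W) {κ : ℝ} (hκ : 0 ≤ κ)
    (hbound : ∀ z ∈ W, Metric.infDist z {z' | P z' ∈ D} ≤ κ * Metric.infDist (P z) D)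
    {z w : Eu d} (hzD : P z ∈ D) (hzW : z ∈ W) (hw : w ∈ rnc {z' | P z' ∈ D} z)
    {ε : ℝ} (hε : 0 < ε) :
    ∃ x y l, ‖x - z‖ < ε ∧ y ∈ D ∧ ‖y - P z‖ < ε ∧ l ∈ rnc D y ∧ ‖l‖ ≤ κ * ‖w‖ + ε ∧
      ‖w - ContinuousLinearMap.adjoint (fderiv ℝ P x) l‖ ≤ ε := by
  have hdiff : Differentiable ℝ P := hP.differentiable one_ne_zero
  have hΩ : IsClosed {z' | P z' ∈ D} := hD.preimage hP.continuous
  set M : ℝ := κ * ‖w‖ with hM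
  have hM0 : 0 ≤ M := by positivity
  set C : ℝ := ‖fderiv ℝ P z‖ + 1 with hC
  have hC1 : 1 ≤ C := by have := norm_nonneg (fderiv ℝ P z); linarith
  set e : ℝ := ε / 8 with he
  have he0 : 0 < e := by positivity
  obtain ⟨r₁, hr₁, hpen⟩ := inner_le_infDist_of_mem_rnc hΩ hzD hw he0
  have hcont : ∀ᶠ x in 𝓝 z, ‖fderiv ℝ P x‖ < C :=
    (hP.continuous_fderiv one_ne_zero).norm.continuousAt.eventually_lt_const (by linarith)
  obtain ⟨r₂, hr₂, hnear⟩ := Metric.eventually_nhds_iff.1 (hcont.and (hW.mem_nhds hzW))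
  obtain ⟨r, hr, hrlt⟩ := exists_between (lt_min hr₁ (lt_min hr₂ hε))
  simp only [lt_min_iff] at hrlt
  obtain ⟨hrr₁, hrr₂, hrε⟩ := hrlt
  set ρ : ℝ := ε / (4 * C) with hρ
  have hρ0 : 0 < ρ := by positivity
  have hρC : C * (2 * ρ) = ε / 2 := by rw [hρ]; field_simp; norm_num
  have hρε : 2 * ρ ≤ ε / 2 := by nlinarith
  set m : ℝ := min (ρ ^ 2) (e * r)
  have hm0 : 0 < m := by positivity
  set η : ℝ := m / (M + 1) with hη
  have hη0 : 0 < η := by positivity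
  have hMη : M * η < m := by
    have : (M + 1) * η = m := by rw [hη]; field_simp
    linarith
  have hlow : ∀ x, ‖x - z‖ ≤ r → ∀ y ∈ D,
      ⟪w, x - z⟫ ≤ M * √(‖P x - y‖ ^ 2 + η ^ 2) + 2 * e * ‖x - z‖ := by
    intro x hx y hy
    have h₁ := hpen x (by linarith)
    have h₂ := hbound x (hnear (by rw [dist_eq_norm]; linarith)).2
    have h₃ : Metric.infDist (P x) D ≤ ‖P x - y‖ := by
      rw [← dist_eq_norm]; exact Metric.infDist_le_dist_of_mem hy
    have h₄ : ‖P x - y‖ ≤ √(‖P x - y‖ ^ 2 + η ^ 2) :=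
      Real.le_sqrt_of_sq_le (by nlinarith [sq_nonneg η])
    have h₅ : ‖w‖ * Metric.infDist x {z' | P z' ∈ D} ≤ ‖w‖ * (κ * ‖P x - y‖) := by
      gcongr
      exact h₂.trans (by gcongr)
    have h₆ : M * ‖P x - y‖ ≤ M * √(‖P x - y‖ ^ 2 + η ^ 2) := by gcongr
    rw [hM] at h₆ ⊢
    linarith
  set G : Eu d → Eu s → ℝ := fun x y =>
    M * √(‖P x - y‖ ^ 2 + η ^ 2) + (‖y - P z‖ ^ 2 - ⟪w, x - z⟫) with hG
  have hPc := hP.continuous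
  obtain ⟨⟨x, y⟩, ⟨hxK, hyK, hyD⟩, hmin⟩ :=
    ((isCompact_closedBall z r).prod ((isCompact_closedBall (P z) ρ).inter_right hD)).exists_isMinOn
      (f := fun q : Eu d × Eu s => G q.1 q.2 + 3 * e * ‖q.1 - z‖)
      ⟨(z, P z), Metric.mem_closedBall_self hr.le, Metric.mem_closedBall_self hρ0.le, hzD⟩
      (by simp only [hG]; fun_prop)
  have hmin' : ∀ x', ‖x' - z‖ ≤ r → ∀ y' ∈ D, ‖y' - P z‖ ≤ ρ →
      G x y + 3 * e * ‖x - z‖ ≤ G x' y' + 3 * e * ‖x' - z‖ := fun x' hx' y' hy' hy'' =>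
    isMinOn_iff.1 hmin (x', y') ⟨by simpa [dist_eq_norm] using hx',
      by simpa [dist_eq_norm] using hy'', hy'⟩
  have hxr : ‖x - z‖ ≤ r := by simpa [dist_eq_norm] using hxK
  have hyρ : ‖y - P z‖ ≤ ρ := by simpa [dist_eq_norm] using hyK
  have hval : ‖y - P z‖ ^ 2 + e * ‖x - z‖ < m := by
    have h₁ := hmin' z (by simpa using hr.le) (P z) hzD (by simpa using hρ0.le)
    have h₂ := hlow x hxr y hyD
    simp only [hG, sub_self, norm_zero, inner_zero_right, ne_eq, OfNat.ofNat_ne_zero,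
      not_false_eq_true, zero_pow, zero_add, Real.sqrt_sq hη0.le, mul_zero, add_zero] at h₁
    linarith
  have hxr' : ‖x - z‖ < r := by
    have : e * ‖x - z‖ < e * r := by
      have := min_le_right (ρ ^ 2) (e * r)
      nlinarith [sq_nonneg ‖y - P z‖]
    exact lt_of_mul_lt_mul_left this he0.le
  have hyρ' : ‖y - P z‖ < ρ := by
    have := min_le_left (ρ ^ 2) (e * r)
    exact lt_of_pow_lt_pow_left₀ 2 hρ0.le (by nlinarith [norm_nonneg (x - z)])
  set u : Eu s := (√(‖P x - y‖ ^ 2 + η ^ 2))⁻¹ • (P x - y) with hu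
  have hu1 : ‖u‖ ≤ 1 := norm_inv_sqrt_smul_le _ _
  set A := ContinuousLinearMap.adjoint (fderiv ℝ P x) with hA
  have hAC : ‖A‖ ≤ C := by
    rw [hA, LinearIsometryEquiv.norm_map]
    exact (hnear (by rw [dist_eq_norm]; linarith)).1.le
  have hGx : HasFDerivAt (fun x => G x y) (innerSL ℝ (M • A u - w)) x := by
    have h₁ := (hasFDerivAt_sqrt_norm_sq_add
      ((hdiff x).hasFDerivAt.sub_const y) hη0).const_mul M
    have h₂ : HasFDerivAt (fun x => ⟪w, x - z⟫) (innerSL ℝ w) x :=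
      (innerSL ℝ w).hasFDerivAt.comp x ((hasFDerivAt_id x).sub_const z)
    refine (h₁.add (h₂.const_sub (‖y - P z‖ ^ 2))).congr_fderiv ?_
    ext v
    simp [hu, hA, ContinuousLinearMap.adjoint_inner_left]
    ring
  have hGy : HasFDerivAt (fun y => G x y) (innerSL ℝ (-(M • u - (2 : ℝ) • (y - P z)))) y := by
    have h₁ := (hasFDerivAt_sqrt_norm_sq_add
      ((hasFDerivAt_id y).const_sub (P x)) hη0).const_mul M
    have h₂ := (((hasFDerivAt_id y).sub_const (P z)).norm_sq).sub_const ⟪w, x - z⟫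
    refine (h₁.add h₂).congr_fderiv ?_
    ext v
    simp [hu, ContinuousLinearMap.adjoint_inner_left]
    ring
  have hgrad : ‖M • A u - w‖ ≤ 3 * e + e := by
    refine norm_gradient_le hGx ?_ (by positivity) he0
    filter_upwards [(continuous_id.sub continuous_const).norm.continuousAt.eventually_lt_const
      (show ‖id x - z‖ < r from hxr')] with x' hx'
    have h₁ := hmin' x' hx'.le y hyD hyρ
    have h₂ : ‖x' - z‖ ≤ ‖x' - x‖ + ‖x - z‖ := norm_sub_le_norm_sub_add_norm_sub _ _ _
    nlinarith
  have hsmall : ‖(2 : ℝ) • (y - P z)‖ ≤ 2 * ρ := by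
    rw [norm_smul, Real.norm_of_nonneg zero_le_two]; linarith
  refine ⟨x, y, M • u - (2 : ℝ) • (y - P z), by linarith, hyD, by linarith, ?_, ?_, ?_⟩
  · intro e' he'
    have := inner_neg_gradient_le (S := D) (c := 0) hGy (by
      filter_upwards [(continuous_id.sub continuous_const).norm.continuousAt.eventually_lt_const
        (show ‖id y - P z‖ < ρ from hyρ')] with y' hy' hy'D
      have h₁ := hmin' x hxr y' hy'D hy'.le
      linarith) he'
    simpa only [neg_neg, zero_add] using this
  · have h₁ : ‖M • u‖ ≤ M := by
      rw [norm_smul, Real.norm_of_nonneg hM0]; exact mul_le_of_le_one_right hM0 hu1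
    linarith [norm_sub_le (M • u) ((2 : ℝ) • (y - P z))]
  · change ‖w - A (M • u - (2 : ℝ) • (y - P z))‖ ≤ ε
    have h₁ : w - A (M • u - (2 : ℝ) • (y - P z)) =
        A ((2 : ℝ) • (y - P z)) - (M • A u - w) := by
      rw [map_sub, map_smul]; abel
    have h₂ : ‖A ((2 : ℝ) • (y - P z))‖ ≤ C * (2 * ρ) := A.le_of_opNorm_le_of_le hAC hsmall
    rw [h₁]
    linarith [norm_sub_le (A ((2 : ℝ) • (y - P z))) (M • A u - w)]

theorem tendsto_clm_apply {α E F : Type*} [NormedAddCommGroup E] [NormedSpace ℝ E]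
    [NormedAddCommGroup F] [NormedSpace ℝ F] {f : Filter α} {A : α → E →L[ℝ] F} {A₀ : E →L[ℝ] F}
    {l : α → E} {l₀ : E} (hA : Tendsto A f (𝓝 A₀)) (hl : Tendsto l f (𝓝 l₀)) :
    Tendsto (fun k => A k (l k)) f (𝓝 (A₀ l₀)) :=
  (isBoundedBilinearMap_apply.continuous.tendsto (A₀, l₀)).comp (hA.prodMk_nhds hl)

/-- bounded multiplier property under MSCQ: if
`dist(z, Ω) ≤ κ ⬝ dist(P(z), D)` on an open neighborhood `W` of `zb`, then for every
`z ∈ Ω ∩ W` one has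
`N_Ω(z) ⊆ {z* | ∃ λ ∈ N_D(P(z)), ‖λ‖ ≤ κ‖z*‖, z* = ∇P(z)ᵀλ}`. -/
theorem stmt_10 {d s : ℕ} (P : Eu d → Eu s) (D : Set (Eu s)) (zb : Eu d)
    (hP : ContDiff ℝ 1 P) (hD : IsClosed D) (hz : P zb ∈ D)
    (W : Set (Eu d)) (hWopen : IsOpen W) (hzbW : zb ∈ W) (κ : ℝ) (hκ : 0 ≤ κ)
    (hbound : ∀ z ∈ W, Metric.infDist z {z' | P z' ∈ D} ≤ κ * Metric.infDist (P z) D) :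
    ∀ z ∈ {z' | P z' ∈ D} ∩ W,
      lnc {z' | P z' ∈ D} z ⊆
        {zs | ∃ l ∈ lnc D (P z), ‖l‖ ≤ κ * ‖zs‖ ∧
          zs = ContinuousLinearMap.adjoint (fderiv ℝ P z) l} := by
  rintro z ⟨hzD, hzW⟩ v ⟨zs, ws, hzs, hzt, hwt, hws⟩
  have happrox : ∀ k : ℕ, ∃ x y l, ‖x - z‖ < 1 / ((k : ℝ) + 1) ∧ y ∈ D ∧
      ‖y - P z‖ < 1 / ((k : ℝ) + 1) ∧ l ∈ rnc D y ∧ ‖l‖ ≤ κ * ‖v‖ + 1 / ((k : ℝ) + 1) ∧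
      ‖v - ContinuousLinearMap.adjoint (fderiv ℝ P x) l‖ ≤ 1 / ((k : ℝ) + 1) := by
    intro k
    set ε : ℝ := 1 / ((k : ℝ) + 1)
    have hε : 0 < ε / 2 := by positivity
    have hPt : Tendsto (fun n => P (zs n)) atTop (𝓝 (P z)) :=
      (hP.continuous.tendsto z).comp hzt
    have hnt : Tendsto (fun n => κ * ‖ws n‖) atTop (𝓝 (κ * ‖v‖)) := hwt.norm.const_mul κ
    obtain ⟨n, hnW, hnz, hnP, hnw, hnn⟩ := ((hzt.eventually_mem (hWopen.mem_nhds hzW)).and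
      ((hzt.eventually (Metric.ball_mem_nhds z hε)).and
      ((hPt.eventually (Metric.ball_mem_nhds (P z) hε)).and
      ((hwt.eventually (Metric.ball_mem_nhds v hε)).and
      (hnt.eventually_lt_const (lt_add_of_pos_right _ hε)))))).exists
    rw [dist_eq_norm] at hnz hnP hnw
    obtain ⟨x, y, l, hx, hyD, hy, hl, hln, hlw⟩ :=
      exists_approx_multiplier hP hD hWopen hκ hbound (hzs n) hnW (hws n) hε
    refine ⟨x, y, l, ?_, hyD, ?_, hl, by linarith, ?_⟩
    · linarith [norm_sub_le_norm_sub_add_norm_sub x (zs n) z]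
    · linarith [norm_sub_le_norm_sub_add_norm_sub y (P (zs n)) (P z)]
    · rw [norm_sub_rev] at hnw
      linarith [norm_sub_le_norm_sub_add_norm_sub v (ws n)
        (ContinuousLinearMap.adjoint (fderiv ℝ P x) l)]
  choose x y l hx hyD hy hl hln hlw using happrox
  have hlim : Tendsto (fun k : ℕ => 1 / ((k : ℝ) + 1)) atTop (𝓝 0) :=
    tendsto_one_div_add_atTop_nhds_zero_nat
  have hxt : Tendsto x atTop (𝓝 z) :=
    tendsto_iff_norm_sub_tendsto_zero.2 (squeeze_zero (fun _ => norm_nonneg _)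
      (fun k => (hx k).le) hlim)
  have hyt : Tendsto y atTop (𝓝 (P z)) :=
    tendsto_iff_norm_sub_tendsto_zero.2 (squeeze_zero (fun _ => norm_nonneg _)
      (fun k => (hy k).le) hlim)
  have hAt : Tendsto (fun k => ContinuousLinearMap.adjoint (fderiv ℝ P (x k)) (l k)) atTop
      (𝓝 v) := by
    refine tendsto_iff_norm_sub_tendsto_zero.2 (squeeze_zero (fun _ => norm_nonneg _)
      (fun k => ?_) hlim)
    rw [norm_sub_rev]
    exact hlw k
  have hlK : ∀ k, l k ∈ Metric.closedBall (0 : Eu s) (κ * ‖v‖ + 1) := by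
    intro k
    rw [mem_closedBall_zero_iff]
    have : 1 / ((k : ℝ) + 1) ≤ 1 := div_le_one_of_le₀ (by simp) (by positivity)
    linarith [hln k]
  obtain ⟨l₀, -, φ, hφ, hlt⟩ := (isCompact_closedBall (0 : Eu s) (κ * ‖v‖ + 1)).tendsto_subseq hlK
  have hφt := hφ.tendsto_atTop
  refine ⟨l₀, ⟨y ∘ φ, l ∘ φ, fun k => hyD _, hyt.comp hφt, hlt, fun k => hl _⟩, ?_, ?_⟩
  · have h := hlim.comp hφt |>.const_add (κ * ‖v‖)
    rw [add_zero] at h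
    exact le_of_tendsto_of_tendsto' hlt.norm h fun k => hln _
  · have hadj : Tendsto (fun k => ContinuousLinearMap.adjoint (fderiv ℝ P (x k))) atTop
        (𝓝 (ContinuousLinearMap.adjoint (fderiv ℝ P z))) :=
      ((ContinuousLinearMap.adjoint.continuous.comp
        (hP.continuous_fderiv one_ne_zero)).tendsto z).comp hxt
    exact tendsto_nhds_unique (hAt.comp hφt) (tendsto_clm_apply (hadj.comp hφt) hlt)
end
end
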